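/- Let G be a finite group whose lattice L of normal subgroups is M2-free, and let {e} = S_0 < S_1 < ⋯ < S_n = G be the increasing enumeration of all elements of L that cut L. Then the clone Comp(G) of congruence preserving functions of G is finitely generated if and only if for each i ∈ {0,…,n−1}, the interval I[S_i, S_{i+1}] of L either contains exactly the two elements S_i and S_{i+1}, or does not split. -/

import Mathlib

/-- A finitary operation on `A`. -/
abbrev FinOp (A : Type*) := Σ n : ℕ, (Fin n → A) → A

/-- Membership in the clone generated by a set `F` of finitary operations:
the smallest set of finitary operations containing `F` and all projections
and closed under composition. -/
inductive InClone {A : Type*} (F : Set (FinOp A)) : {n : ℕ} → ((Fin n → A) → A) → Prop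
  | proj {n : ℕ} (i : Fin n) : InClone F fun x => x i
  | base {n : ℕ} (f : (Fin n → A) → A) : (⟨n, f⟩ : FinOp A) ∈ F → InClone F f
  | comp {n m : ℕ} (f : (Fin m → A) → A) (g : Fin m → (Fin n → A) → A) :
      InClone F f → (∀ i, InClone F (g i)) → InClone F fun x => f fun i => g i x

/-- A function `G^k → G` is compatible (congruence preserving): it preserves
every congruence, i.e. for every normal subgroup `N` and tuples `a ≡ b mod N`
one has `f a ≡ f b mod N`. -/
def Compatible {G : Type*} [Group G] {k : ℕ} (f : (Fin k → G) → G) : Prop :=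
  ∀ N : Subgroup G, N.Normal → ∀ a b : Fin k → G,
    (∀ i, (a i)⁻¹ * b i ∈ N) → (f a)⁻¹ * f b ∈ N

/-- The clone `Comp G` of congruence preserving functions of `G` is finitely
generated: some finite set of compatible functions generates, as a clone,
exactly the compatible functions (of all arities `≥ 1`). -/
def CompFG (G : Type*) [Group G] : Prop :=
  ∃ F : Set (FinOp G), F.Finite ∧ (∀ f ∈ F, 1 ≤ f.1 ∧ Compatible f.2) ∧
    ∀ (n : ℕ), 1 ≤ n → ∀ f : (Fin n → G) → G, (Compatible f ↔ InClone F f)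

/-- The lattice of normal subgroups of `G`. -/
instance NormalSubgroup.instLattice {G : Type*} [Group G] :
    Lattice {N : Subgroup G // N.Normal} :=
  Subtype.lattice (fun _ _ hA hB => @Subgroup.sup_normal _ _ _ _ hA hB)
    (fun _ _ hA hB => @Subgroup.normal_inf_normal _ _ _ _ hA hB)

instance NormalSubgroup.instBoundedOrder {G : Type*} [Group G] :
    BoundedOrder {N : Subgroup G // N.Normal} where
  top := ⟨⊤, inferInstance⟩
  le_top A := (le_top : A.1 ≤ ⊤)
  bot := ⟨⊥, inferInstance⟩
  bot_le A := (bot_le : ⊥ ≤ A.1)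

/-- `β` cuts the lattice: every element is comparable with `β`. -/
def Cuts {L : Type*} [Lattice L] (β : L) : Prop := ∀ α : L, α ≤ β ∨ β ≤ α

/-- The interval `I[a,b]` splits: it has a splitting pair `(δ, ε)`. -/
def IntervalSplits {L : Type*} [Lattice L] (a b : L) : Prop :=
  ∃ δ ε : L, a ≤ δ ∧ δ < b ∧ a < ε ∧ ε ≤ b ∧
    ∀ K : L, a ≤ K → K ≤ b → K ≤ δ ∨ ε ≤ K

/-- A lattice is `M₂`-free if no interval `I[a,d]` consists of exactly four
elements `a < b, c < d` with `b` and `c` incomparable. -/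
def M2Free (L : Type*) [Lattice L] : Prop :=
  ¬ ∃ a b c d : L, a < b ∧ a < c ∧ b < d ∧ c < d ∧ ¬ b ≤ c ∧ ¬ c ≤ b ∧
      ∀ x : L, a ≤ x → x ≤ d → x = a ∨ x = b ∨ x = c ∨ x = d

section CompatibleFunctions

variable {G : Type*} [Group G] {k m : ℕ}

theorem Compatible.proj (i : Fin k) : Compatible fun x : Fin k → G => x i :=
  fun _ _ _ _ h => h i

theorem Compatible.const (c : G) : Compatible fun _ : Fin k → G => c :=
  fun N _ _ _ _ => by simp

theorem Compatible.comp {f : (Fin m → G) → G} {g : Fin m → (Fin k → G) → G}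
    (hf : Compatible f) (hg : ∀ i, Compatible (g i)) :
    Compatible fun x => f fun i => g i x :=
  fun N hN a b h => hf N hN _ _ fun i => hg i N hN a b h

theorem Compatible.mul {f g : (Fin k → G) → G} (hf : Compatible f) (hg : Compatible g) :
    Compatible fun x => f x * g x := by
  intro N hN a b h
  have h1 := hN.conj_mem _ (hf N hN a b h) (g a)⁻¹
  have h2 := N.mul_mem h1 (hg N hN a b h)
  convert h2 using 1
  group

theorem Compatible.inv {f : (Fin k → G) → G} (hf : Compatible f) :
    Compatible fun x => (f x)⁻¹ := by
  intro N hN a b h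
  have h1 := hN.conj_mem _ (N.inv_mem (hf N hN a b h)) (f a)
  convert h1 using 1
  group

theorem Compatible.update {f : (Fin k → G) → G} (hf : Compatible f) (j : Fin k)
    {g : (Fin k → G) → G} (hg : Compatible g) :
    Compatible fun x => f (Function.update x j (g x)) := by
  have : ∀ i, Compatible fun x : Fin k → G => Function.update x j (g x) i := by
    intro i
    by_cases h : i = j
    · subst h; simpa using hg
    · simpa [h] using Compatible.proj i
  exact hf.comp this

theorem InClone.compatible {F : Set (FinOp G)} (hF : ∀ f ∈ F, Compatible f.2)
    {f : (Fin k → G) → G} (hf : InClone F f) : Compatible f := by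
  induction hf with
  | proj i => exact Compatible.proj i
  | base f h => exact hF _ h
  | comp f g _ _ ihf ihg => exact ihf.comp ihg

/-- A function `f` depends only on the coordinates in `J`. -/
def DependsOnlyOn {ι X Y : Type*} (f : (ι → X) → Y) (J : Finset ι) : Prop :=
  ∀ x y : ι → X, (∀ i ∈ J, x i = y i) → f x = f y

/-- The compatible functions of arity `m`. -/
def compatibleOps (G : Type*) [Group G] (m : ℕ) : Set (FinOp G) :=
  {f | f.1 = m ∧ Compatible f.2}

theorem compatibleOps_finite [Finite G] (m : ℕ) : (compatibleOps G m).Finite := by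
  refine (Set.finite_range fun f : (Fin m → G) → G => (⟨m, f⟩ : FinOp G)).subset ?_
  rintro ⟨n, f⟩ ⟨h, -⟩
  obtain rfl : n = m := h
  exact ⟨f, rfl⟩

theorem InClone.of_dependsOnlyOn (hk : 1 ≤ k) {f : (Fin k → G) → G} (hf : Compatible f)
    {J : Finset (Fin k)} (hJ : DependsOnlyOn f J) (hm : J.card ≤ m) :
    InClone (compatibleOps G m) f := by
  classical
  let σ : Fin k → Option (Fin m) := fun i =>
    if h : i ∈ J then some (Fin.castLE hm (J.equivFin ⟨i, h⟩)) else none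
  let π : Fin m → Fin k := fun j =>
    if h : j.1 < J.card then (J.equivFin.symm ⟨j.1, h⟩).1 else ⟨0, hk⟩
  have hσπ : ∀ i (h : i ∈ J), π (Fin.castLE hm (J.equivFin ⟨i, h⟩)) = i := by
    intro i h
    simp [π]
  let f' : (Fin m → G) → G := fun y => f fun i => if h : i ∈ J then
    y (Fin.castLE hm (J.equivFin ⟨i, h⟩)) else 1
  have hf' : Compatible f' := by
    refine hf.comp fun i => ?_
    by_cases h : i ∈ J
    · simpa [h] using Compatible.proj _
    · simpa [h] using Compatible.const (1 : G)
  have h := InClone.comp f' (fun j (x : Fin k → G) => x (π j))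
    (InClone.base f' (show _ ∈ compatibleOps G m from ⟨rfl, hf'⟩)) fun j => InClone.proj _
  convert h using 2 with x
  apply hJ
  intro i hi
  simp [hi, hσπ]

theorem InClone.const (hk : 1 ≤ k) (c : G) :
    InClone (compatibleOps G m) fun _ : Fin k → G => c :=
  InClone.of_dependsOnlyOn hk (Compatible.const c) (J := ∅) (fun _ _ _ => rfl) (by simp)

theorem InClone.comp₂ (hm : 2 ≤ m) {f : (Fin 2 → G) → G} (hf : Compatible f)
    {g h : (Fin k → G) → G} (hg : InClone (compatibleOps G m) g)
    (hh : InClone (compatibleOps G m) h) :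
    InClone (compatibleOps G m) fun x => f ![g x, h x] := by
  have h1 : InClone (compatibleOps G m) f :=
    InClone.of_dependsOnlyOn (by norm_num) hf (J := Finset.univ)
      (fun x y h => by rw [show x = y from funext fun i => h i (Finset.mem_univ i)]) (by simpa)
  have h2 := InClone.comp f ![g, h] h1 (by intro i; fin_cases i <;> assumption)
  convert h2 using 3 with x
  ext i; fin_cases i <;> rfl

theorem InClone.mul (hm : 2 ≤ m) {g h : (Fin k → G) → G} (hg : InClone (compatibleOps G m) g)
    (hh : InClone (compatibleOps G m) h) :
    InClone (compatibleOps G m) fun x => g x * h x := by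
  have := InClone.comp₂ hm (f := fun y : Fin 2 → G => y 0 * y 1)
    ((Compatible.proj 0).mul (Compatible.proj 1)) hg hh
  simpa using this

end CompatibleFunctions

section Sift

variable {G : Type*} [Group G] {k m : ℕ} {B H : Subgroup G}

open Classical in
/-- The functions that cut off `y ∈ H` outside a coset of `B` are compatible, provided that
`B ≤ H` and every normal subgroup is below `B` or above `H`. -/
theorem Compatible.sift (hBH : B ≤ H) (hcut : ∀ N : Subgroup G, N.Normal → N ≤ B ∨ H ≤ N) (a : G) :
    Compatible fun y : Fin 2 → G => if a⁻¹ * y 0 ∈ B ∧ y 1 ∈ H then y 1 else 1 := by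
  intro N hN x y hxy
  rcases hcut N hN with hN' | hN'
  · have h0 : a⁻¹ * x 0 ∈ B ↔ a⁻¹ * y 0 ∈ B := by
      have : a⁻¹ * y 0 = (a⁻¹ * x 0) * ((x 0)⁻¹ * y 0) := by group
      rw [this]
      exact (B.mul_mem_cancel_right (hN' (hxy 0))).symm
    have h1 : x 1 ∈ H ↔ y 1 ∈ H := by
      have : y 1 = x 1 * ((x 1)⁻¹ * y 1) := by group
      rw [this]
      exact (H.mul_mem_cancel_right (hBH (hN' (hxy 1)))).symm
    simp only [h0, h1]
    split_ifs
    · exact hxy 1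
    · simp
  · apply hN'
    have : ∀ z : Fin 2 → G, (if a⁻¹ * z 0 ∈ B ∧ z 1 ∈ H then z 1 else 1) ∈ H := by
      intro z
      split_ifs with h
      · exact h.2
      · exact H.one_mem
    exact H.mul_mem (H.inv_mem (this x)) (this y)

open Classical in
theorem InClone.sift (hm : 2 ≤ m) (hBH : B ≤ H)
    (hcut : ∀ N : Subgroup G, N.Normal → N ≤ B ∨ H ≤ N) (a : Fin k → G)
    {g : (Fin k → G) → G} (hg : InClone (compatibleOps G m) g) (hgH : ∀ x, g x ∈ H) :
    InClone (compatibleOps G m) fun x => if ∀ i, (a i)⁻¹ * x i ∈ B then g x else 1 := by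
  have key : ∀ T : Finset (Fin k),
      InClone (compatibleOps G m) fun x => if ∀ i ∈ T, (a i)⁻¹ * x i ∈ B then g x else 1 := by
    intro T
    induction T using Finset.induction_on with
    | empty => simpa using hg
    | insert j T _ ih =>
      have := InClone.comp₂ hm (Compatible.sift hBH hcut (a j)) (InClone.proj j) ih
      convert this using 2 with x
      simp only [Finset.forall_mem_insert, Matrix.cons_val_zero, Matrix.cons_val_one]
      by_cases h2 : ∀ i ∈ T, (a i)⁻¹ * x i ∈ B
      · simp only [if_pos h2, hgH x, and_true, and_iff_left h2]
      · simp [h2]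
  simpa using key Finset.univ

/-- If on each coset of `B` a function agrees modulo `N` with a member of the clone vanishing off
that coset, then it agrees modulo `N` with a member of the clone. -/
theorem InClone.exists_of_forall_coset [Finite G] {N : Subgroup G} (hm : 2 ≤ m) (hk : 1 ≤ k)
    (h : (Fin k → G) → G)
    (hloc : ∀ a : Fin k → G, ∃ g, InClone (compatibleOps G m) g ∧
      (∀ x, (∀ i, (a i)⁻¹ * x i ∈ B) → (g x)⁻¹ * h x ∈ N) ∧
      ∀ x, (¬ ∀ i, (a i)⁻¹ * x i ∈ B) → g x = 1) :
    ∃ g, InClone (compatibleOps G m) g ∧ ∀ x, (g x)⁻¹ * h x ∈ N := by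
  classical
  have key : ∀ T : Set (Fin k → G ⧸ B), ∃ g, InClone (compatibleOps G m) g ∧
      (∀ x : Fin k → G, (fun i => (x i : G ⧸ B)) ∈ T → (g x)⁻¹ * h x ∈ N) ∧
      ∀ x : Fin k → G, (fun i => (x i : G ⧸ B)) ∉ T → g x = 1 := by
    intro T
    induction T, T.toFinite using Set.Finite.induction_on with
    | empty => exact ⟨fun _ => 1, InClone.const hk 1, by simp, by simp⟩
    | @insert q T hq _ ih =>
      obtain ⟨g, hg, hg1, hg2⟩ := ih
      obtain ⟨g', hg', hg'1, hg'2⟩ := hloc fun i => (q i).out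
      have hiff : ∀ x : Fin k → G, (∀ i, ((q i).out)⁻¹ * x i ∈ B) ↔
          (fun i => (x i : G ⧸ B)) = q := by
        intro x
        rw [funext_iff]
        refine forall_congr' fun i => ?_
        rw [← QuotientGroup.eq, QuotientGroup.out_eq', eq_comm]
      refine ⟨_, hg.mul hm hg', ?_, ?_⟩
      · intro x hx
        rcases hx with hx | hx
        · rw [hg2 x (by rwa [hx]), one_mul]
          exact hg'1 x ((hiff x).2 hx)
        · rw [hg'2 x (fun hc => hq (by rwa [← (hiff x).1 hc])), mul_one]
          exact hg1 x hx
      · intro x hx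
        rw [Set.mem_insert_iff, not_or] at hx
        rw [hg2 x hx.2, hg'2 x (by rw [hiff]; exact hx.1), mul_one]
  obtain ⟨g, hg, hg1, -⟩ := key Set.univ
  exact ⟨g, hg, fun x => hg1 x trivial⟩

end Sift

section NonSplitting

variable {G : Type*} [Group G]

/-- A compatible function which on the coset of `H` given by `a` takes values in `R`, and values
in `S` as soon as some coordinate in `J` is equal to that of `a`. -/
structure AbsorbingOn {k : ℕ} (S R H : Subgroup G) (a : Fin k → G) (J : Finset (Fin k))
    (v : (Fin k → G) → G) : Prop where
  compatible : Compatible v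
  mem : ∀ x, (∀ i, (a i)⁻¹ * x i ∈ H) → v x ∈ R
  absorb : ∀ x, (∀ i, (a i)⁻¹ * x i ∈ H) → ∀ j ∈ J, x j = a j → v x ∈ S

theorem inv_mul_update_mem {k : ℕ} {H : Subgroup G} {a x : Fin k → G}
    (hx : ∀ i, (a i)⁻¹ * x i ∈ H) {j : Fin k} {y : G} (hy : (a j)⁻¹ * y ∈ H) (i : Fin k) :
    (a i)⁻¹ * Function.update x j y i ∈ H := by
  by_cases h : i = j
  · subst h; simpa using hy
  · simpa [h] using hx i

theorem AbsorbingOn.fix {k : ℕ} {S R H : Subgroup G} {a : Fin k → G} {J : Finset (Fin k)}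
    {v : (Fin k → G) → G} (hv : AbsorbingOn S R H a J v) (N : Subgroup G) (hN : N.Normal)
    (hSN : S ≤ N) {j : Fin k} (hj : j ∈ J) {z : G} (hzH : (a j)⁻¹ * z ∈ H)
    (hz : (a j)⁻¹ * z ∈ N) :
    AbsorbingOn S (R ⊓ N) H a (J.erase j) fun x => v (Function.update x j z) where
  compatible := hv.compatible.update j (Compatible.const z)
  mem x hx := by
    refine ⟨hv.mem _ (inv_mul_update_mem hx hzH), ?_⟩
    have h1 := hv.compatible N hN (Function.update x j (a j)) (Function.update x j z) (by
      intro i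
      by_cases h : i = j
      · subst h; simpa using hz
      · simp [h])
    have h2 := hSN (hv.absorb (Function.update x j (a j))
      (inv_mul_update_mem hx (by simp)) j hj (by simp))
    exact (N.mul_mem_cancel_left (N.inv_mem h2)).1 h1
  absorb x hx i hi hxi := by
    rw [Finset.mem_erase] at hi
    exact hv.absorb _ (inv_mul_update_mem hx hzH) i hi.2 (by simpa [hi.1] using hxi)

theorem AbsorbingOn.shift {k : ℕ} {S R H : Subgroup G} {a : Fin k → G} {J : Finset (Fin k)}
    {v : (Fin k → G) → G} (hv : AbsorbingOn S R H a J v) {j : Fin k} {z : G}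
    (hz : z ∈ H) :
    AbsorbingOn S R H a J fun x =>
      v (Function.update x j (x j * z)) * (v (Function.update x j (a j * z)))⁻¹ where
  compatible := (hv.compatible.update j ((Compatible.proj j).mul (Compatible.const z))).mul
    (hv.compatible.update j (Compatible.const _)).inv
  mem x hx := by
    refine R.mul_mem (hv.mem _ (inv_mul_update_mem hx ?_))
      (R.inv_mem (hv.mem _ (inv_mul_update_mem hx (by simpa using hz))))
    rw [← mul_assoc]; exact H.mul_mem (hx j) hz
  absorb x hx i hi hxi := by
    by_cases h : i = j
    · subst h; simp [hxi]
    · refine S.mul_mem (hv.absorb _ (inv_mul_update_mem hx ?_) i hi (by simpa [h] using hxi))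
        (S.inv_mem (hv.absorb _ (inv_mul_update_mem hx (by simpa using hz)) i hi
          (by simpa [h] using hxi)))
      rw [← mul_assoc]; exact H.mul_mem (hx j) hz

/-- If the interval from `S` to `H` does not split, then compatible functions absorbing in
sufficiently many variables are trivial modulo `S`. -/
theorem AbsorbingOn.exists_bound [Finite G] {S H : {N : Subgroup G // N.Normal}}
    (hns : ¬ IntervalSplits S H) (R : {N : Subgroup G // N.Normal}) (hSR : S ≤ R) (hRH : R ≤ H) :
    ∃ r : ℕ, ∀ (k : ℕ) (v : (Fin k → G) → G) (a : Fin k → G) (J : Finset (Fin k)),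
      AbsorbingOn S.1 R.1 H.1 a J v → r ≤ J.card →
        ∀ x, (∀ i, (a i)⁻¹ * x i ∈ H.1) → v x ∈ S.1 := by
  classical
  have := Fintype.ofFinite {N : Subgroup G // N.Normal}
  induction R using WellFoundedLT.induction with
  | _ R ih =>
    rcases hSR.eq_or_lt with rfl | hlt
    · exact ⟨0, fun k v a J hv _ x hx => hv.mem x hx⟩
    choose! r hr using ih
    refine ⟨Finset.univ.sup r + 1, ?_⟩
    let P : {N : Subgroup G // N.Normal} → Prop := fun N =>
      ∀ (k : ℕ) (v : (Fin k → G) → G) (a : Fin k → G) (J : Finset (Fin k)),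
        AbsorbingOn S.1 R.1 H.1 a J v → Finset.univ.sup r + 1 ≤ J.card → ∀ j ∈ J,
          ∀ x, (∀ i, (a i)⁻¹ * x i ∈ H.1) → (a j)⁻¹ * x j ∈ N.1 → v x ∈ S.1
    have hP : ∀ N, S ≤ N → N ≤ H → ¬ R ≤ N → P N := by
      intro N hSN hNH hRN k v a J hv hJ j hj x hx hxj
      have hlt' : R ⊓ N < R := inf_lt_left.2 hRN
      have h1 := hr (R ⊓ N) hlt' (le_inf hSR hSN) (inf_le_left.trans hRH) k _ a _
        (hv.fix N.1 N.2 hSN hj (hx j) hxj) (by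
          rw [Finset.card_erase_of_mem hj]
          have := Finset.le_sup (f := r) (Finset.mem_univ (R ⊓ N))
          omega) x hx
      simpa using h1
    have hsup : ∀ N N', N ≤ H → N' ≤ H → P N → P N' → P (N ⊔ N') := by
      intro N N' hN hN' h h' k v a J hv hJ j hj x hx hxj
      have hn := N'.2
      obtain ⟨y, hy, z, hz, hyz⟩ := Subgroup.mem_sup_of_normal_right.1 hxj
      have h1 := h k _ a J (hv.shift (hN' hz) (j := j)) hJ j hj
        (Function.update x j (a j * y)) (inv_mul_update_mem hx (by simpa using hN hy))
        (by simpa using hy)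
      have h2 := h' k v a J hv hJ j hj (Function.update x j (a j * z))
        (inv_mul_update_mem hx (by simpa using hN' hz)) (by simpa using hz)
      have h3 : a j * y * z = x j := by rw [mul_assoc, hyz]; group
      simp only [Function.update_self, Function.update_idem, h3, Function.update_eq_self] at h1
      exact (S.1.mul_mem_cancel_right (S.1.inv_mem h2)).1 h1
    obtain ⟨D, hD⟩ := (Set.toFinite {N | S ≤ N ∧ N ≤ H ∧ P N}).exists_maximal
      ⟨S, le_rfl, hlt.le.trans hRH, hP S le_rfl (hlt.le.trans hRH) hlt.not_ge⟩
    obtain ⟨hSD, hDH, hPD⟩ := hD.prop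
    have hDeq : D = H := by
      by_contra hne
      refine hns ⟨D, R, hSD, lt_of_le_of_ne hDH hne, hlt, hRH, fun K hSK hKH => ?_⟩
      by_contra! hK
      exact hK.1 (le_sup_right.trans (hD.le_of_ge (y := D ⊔ K) ⟨hSD.trans le_sup_left,
        sup_le hDH hKH, hsup _ _ hDH hKH hPD (hP K hSK hKH hK.2)⟩ le_sup_left))
    subst hDeq
    intro k v a J hv hJ x hx
    obtain ⟨j, hj⟩ := Finset.card_pos.1 (by omega : 0 < J.card)
    exact hPD k v a J hv hJ j hj x hx (hx j)

/-- On a coset of `H`, a function with values in `H` agrees modulo `S` with a member of the clone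
generated by the compatible functions of some large arity. -/
theorem InClone.exists_on_coset {S H : Subgroup G} {m r k : ℕ} (hS : S.Normal) (hm : 2 ≤ m)
    (hrm : r ≤ m) (hk : 1 ≤ k) (hcut : ∀ N : Subgroup G, N.Normal → N ≤ H ∨ H ≤ N)
    (a : Fin k → G)
    (hr : ∀ (v : (Fin k → G) → G) (J : Finset (Fin k)), AbsorbingOn S H H a J v → r ≤ J.card →
        ∀ x, (∀ i, (a i)⁻¹ * x i ∈ H) → v x ∈ S)
    (h : (Fin k → G) → G) (hh : Compatible h) (hhH : ∀ x, h x ∈ H) :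
    ∃ g, InClone (compatibleOps G m) g ∧
      (∀ x, (∀ i, (a i)⁻¹ * x i ∈ H) → (g x)⁻¹ * h x ∈ S) ∧
      ∀ x, (¬ ∀ i, (a i)⁻¹ * x i ∈ H) → g x = 1 := by
  classical
  suffices key : ∀ (n : ℕ) (D J : Finset (Fin k)) (v : (Fin k → G) → G), (D \ J).card = n →
      J ⊆ D → DependsOnlyOn v D → AbsorbingOn S H H a J v → (∀ x, v x ∈ H) →
      ∃ g, InClone (compatibleOps G m) g ∧
        (∀ x, (∀ i, (a i)⁻¹ * x i ∈ H) → (g x)⁻¹ * v x ∈ S) ∧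
        ∀ x, (¬ ∀ i, (a i)⁻¹ * x i ∈ H) → g x = 1 from
    key _ Finset.univ ∅ h rfl (by simp)
      (fun x y hxy => by rw [show x = y from funext fun i => hxy i (Finset.mem_univ i)])
      ⟨hh, fun x _ => hhH x, by simp⟩ hhH
  intro n
  induction n with
  | zero =>
    intro D J v hn hJD hD hv hvH
    obtain rfl : J = D := hJD.antisymm (by simpa using hn)
    rcases le_total r J.card with hc | hc
    · exact ⟨fun _ => 1, InClone.const hk 1, fun x hx => by simpa using hr v J hv hc x hx,
        fun _ _ => rfl⟩
    · refine ⟨_, InClone.sift hm le_rfl hcut a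
        (InClone.of_dependsOnlyOn hk hv.compatible hD (hc.trans hrm)) hvH, ?_, ?_⟩
      · intro x hx
        rw [if_pos hx]; simp
      · intro x hx
        rw [if_neg hx]
  | succ n ih =>
    intro D J v hn hJD hD hv hvH
    obtain ⟨j, hj⟩ := Finset.card_pos.1 (by omega : 0 < (D \ J).card)
    obtain ⟨hjD, hjJ⟩ := Finset.mem_sdiff.1 hj
    have haH : (a j)⁻¹ * a j ∈ H := by simp
    have hne : ∀ i ∈ J, i ≠ j := fun i hi hij => hjJ (hij ▸ hi)
    have hc2 := hv.compatible.update j (Compatible.const (a j))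
    obtain ⟨g₁, hg₁, h11, h12⟩ := ih D (insert j J)
      (fun x => v x * (v (Function.update x j (a j)))⁻¹)
      (by rw [Finset.sdiff_insert, Finset.card_erase_of_mem hj, hn]; rfl)
      (Finset.insert_subset hjD hJD)
      (fun x y hxy => by
        refine congrArg₂ (fun p q => p * q⁻¹) (hD _ _ hxy) (hD _ _ fun i hi => ?_)
        by_cases hij : i = j
        · subst hij; simp
        · simpa [hij] using hxy i hi)
      ⟨hv.compatible.mul hc2.inv, fun x _ => H.mul_mem (hvH _) (H.inv_mem (hvH _)), by
        intro x hx i hi hxi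
        rcases Finset.mem_insert.1 hi with rfl | hi
        · rw [← hxi]; simp
        · exact S.mul_mem (hv.absorb x hx i hi hxi) (S.inv_mem (hv.absorb _
            (inv_mul_update_mem hx haH) i hi (by simpa [hne i hi] using hxi)))⟩
      fun x => H.mul_mem (hvH _) (H.inv_mem (hvH _))
    obtain ⟨g₂, hg₂, h21, h22⟩ := ih (D.erase j) J (fun x => v (Function.update x j (a j)))
      (by rw [← Finset.sdiff_singleton_eq_erase, sdiff_right_comm,
            Finset.sdiff_singleton_eq_erase, Finset.card_erase_of_mem hj, hn]; rfl)
      (fun i hi => Finset.mem_erase.2 ⟨hne i hi, hJD hi⟩)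
      (fun x y hxy => hD _ _ fun i hi => by
          by_cases hij : i = j
          · subst hij; simp
          · simpa [hij] using hxy i (Finset.mem_erase.2 ⟨hij, hi⟩))
      ⟨hc2, fun x _ => hvH _, fun x hx i hi hxi => hv.absorb _
            (inv_mul_update_mem hx haH) i hi (by simpa [hne i hi] using hxi)⟩
      fun x => hvH _
    refine ⟨_, hg₁.mul hm hg₂, fun x hx => ?_, fun x hx => by rw [h12 x hx, h22 x hx, one_mul]⟩
    convert S.mul_mem (hS.conj_mem _ (h11 x hx) (g₂ x)⁻¹) (h21 x hx) using 1
    group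

/-- If each interval between consecutive cutting elements is a prime quotient or does not split,
then all compatible functions are generated by those of some fixed arity. -/
theorem CompFG.of_chain [Finite G] (n : ℕ) (S : Fin (n + 1) → {H : Subgroup G // H.Normal})
    (hmono : StrictMono S) (h0 : S 0 = ⊥) (hlast : S (Fin.last n) = ⊤) (hcuts : ∀ i, Cuts (S i))
    (hS : ∀ i : Fin n,
      (∀ K : {H : Subgroup G // H.Normal}, S i.castSucc ≤ K → K ≤ S i.succ →
          K = S i.castSucc ∨ K = S i.succ)
        ∨ ¬ IntervalSplits (S i.castSucc) (S i.succ)) : CompFG G := by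
  have hle : ∀ i : Fin n, S i.castSucc ≤ S i.succ := fun i => (hmono i.castSucc_lt_succ).le
  have hbound : ∀ i : Fin n, ∃ r : ℕ, ¬ IntervalSplits (S i.castSucc) (S i.succ) →
      ∀ (k : ℕ) (v : (Fin k → G) → G) (a : Fin k → G) (J : Finset (Fin k)),
      AbsorbingOn (S i.castSucc).1 (S i.succ).1 (S i.succ).1 a J v → r ≤ J.card →
        ∀ x, (∀ j, (a j)⁻¹ * x j ∈ (S i.succ).1) → v x ∈ (S i.castSucc).1 := by
    intro i
    by_cases h : IntervalSplits (S i.castSucc) (S i.succ)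
    · exact ⟨0, fun h' => (h' h).elim⟩
    · obtain ⟨r, hr⟩ := AbsorbingOn.exists_bound h _ (hle i) le_rfl
      exact ⟨r, fun _ => hr⟩
  choose r hr using hbound
  let m := Finset.univ.sup r + 2
  have hm : 2 ≤ m := Nat.le_add_left _ _
  refine ⟨compatibleOps G m, compatibleOps_finite m, ?_, fun k hk f => ⟨fun hf => ?_, fun hf =>
    hf.compatible fun f hf => hf.2⟩⟩
  · rintro f ⟨hfm, hf⟩
    exact ⟨by omega, hf⟩
  suffices key : ∀ (i : Fin (n + 1)) (f : (Fin k → G) → G), Compatible f →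
      (∀ x, f x ∈ (S i).1) → InClone (compatibleOps G m) f from
    key (Fin.last n) f hf fun x => by rw [hlast]; exact Subgroup.mem_top _
  intro i
  induction i using Fin.induction with
  | zero =>
    intro f _ hf
    rw [h0] at hf
    rw [show f = fun _ => 1 from funext fun x => Subgroup.mem_bot.1 (hf x)]
    exact InClone.const hk 1
  | succ i ih =>
    intro f hf hfi
    have hcut : ∀ N : Subgroup G, N.Normal → N ≤ (S i.succ).1 ∨ (S i.succ).1 ≤ N :=
      fun N hN => hcuts i.succ ⟨N, hN⟩
    obtain ⟨g, hg, hgf⟩ : ∃ g, InClone (compatibleOps G m) g ∧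
        ∀ x, (g x)⁻¹ * f x ∈ (S i.castSucc).1 := by
      rcases hS i with htwo | hns
      · refine InClone.exists_of_forall_coset (B := (S i.castSucc).1) hm hk f fun a =>
          ⟨_, InClone.sift (H := (S i.succ).1) hm (hle i) (fun N hN => ?_) a
            (InClone.const hk (f a)) (fun _ => hfi a), fun x hx => ?_, fun x hx => if_neg hx⟩
        · rcases hcuts i.castSucc ⟨N, hN⟩ with h | h
          · exact Or.inl h
          · rcases hcut N hN with h' | h'
            · rcases htwo ⟨N, hN⟩ h h' with h'' | h''
              · exact Or.inl h''.le
              · exact Or.inr h''.ge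
            · exact Or.inr h'
        · rw [if_pos hx]
          exact hf _ (S i.castSucc).2 _ _ hx
      · refine InClone.exists_of_forall_coset (B := (S i.succ).1) hm hk f fun a =>
          InClone.exists_on_coset (S i.castSucc).2 hm ?_ hk hcut a
            (fun v J => hr i hns k v a J) f hf hfi
        exact (Finset.le_sup (f := r) (Finset.mem_univ i)).trans (Nat.le_add_right _ _)
    have hgc : Compatible g := hg.compatible fun f hf => hf.2
    have := hg.mul hm (ih _ (hgc.inv.mul hf) hgf)
    simpa using this

end NonSplitting

section Centrality

variable {G : Type*} [Group G]

theorem isModularLattice_normalSubgroup : IsModularLattice {N : Subgroup G // N.Normal} where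
  sup_inf_le_assoc_of_le := by
    rintro ⟨x, hx⟩ ⟨y, hy⟩ ⟨z, hz⟩ hxz w hw
    obtain ⟨hw1, hw2⟩ := hw
    obtain ⟨a, ha, b, hb, rfl⟩ := Subgroup.mem_sup_of_normal_left.1 hw1
    exact Subgroup.mul_mem_sup ha ⟨hb, (z.mul_mem_cancel_left (hxz ha)).1 hw2⟩

/-- The increments of compatible functions in directions from `τ` do not depend, modulo `σ`, on the
position inside a coset of `H`. -/
def CentralMod (σ τ H : {N : Subgroup G // N.Normal}) : Prop :=
  ∀ (m : ℕ) (f : (Fin m → G) → G), Compatible f → ∀ x y z : Fin m → G,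
    (∀ i, (x i)⁻¹ * y i ∈ H.1) → (∀ i, z i ∈ τ.1) →
      ((f x)⁻¹ * f (x * z))⁻¹ * ((f y)⁻¹ * f (y * z)) ∈ σ.1

variable {σ τ H : {N : Subgroup G // N.Normal}}

theorem CentralMod.inf (h : CentralMod σ τ H) (α : {N : Subgroup G // N.Normal}) :
    CentralMod (σ ⊓ α) (τ ⊓ α) H := by
  intro m f hf x y z hxy hz
  have h1 : ∀ w : Fin m → G, (f w)⁻¹ * f (w * z) ∈ α.1 := fun w =>
    hf α.1 α.2 _ _ fun i => by simpa using (hz i).2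
  exact ⟨h m f hf x y z hxy fun i => (hz i).1, α.1.mul_mem (α.1.inv_mem (h1 x)) (h1 y)⟩

theorem CentralMod.sup (h : CentralMod σ τ H) (α : {N : Subgroup G // N.Normal}) :
    CentralMod (σ ⊔ α) (τ ⊔ α) H := by
  intro m f hf x y z hxy hz
  have hα := α.2
  have hσα := (σ ⊔ α).2
  choose t ht r hr htr using fun i => Subgroup.mem_sup_of_normal_right.1 (hz i)
  have h1 : ∀ w : Fin m → G, (f (w * z) : G ⧸ (σ ⊔ α).1) = f (w * t) := fun w =>
    (QuotientGroup.eq.2 ((le_sup_right : α ≤ σ ⊔ α) (hf α.1 α.2 (w * t) (w * z) fun i => by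
      simpa [← htr i, mul_assoc] using hr i))).symm
  have h2 := (le_sup_left : σ ≤ σ ⊔ α) (h m f hf x y t hxy ht)
  rw [← QuotientGroup.eq_one_iff] at h2 ⊢
  simp only [QuotientGroup.mk_mul, QuotientGroup.mk_inv] at h2 ⊢
  rw [h1, h1, h2]

theorem CentralMod.of_inf (b d : {N : Subgroup G // N.Normal}) : CentralMod (b ⊓ d) b d := by
  intro m f hf x y z hxy hz
  have hb : ∀ w : Fin m → G, (f w)⁻¹ * f (w * z) ∈ b.1 := fun w =>
    hf b.1 b.2 _ _ fun i => by simpa using hz i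
  refine ⟨b.1.mul_mem (b.1.inv_mem (hb x)) (hb y), ?_⟩
  have hd := d.2
  have h1 : (f x : G ⧸ d.1) = f y := QuotientGroup.eq.2 (hf d.1 hd x y hxy)
  have h2 : (f (x * z) : G ⧸ d.1) = f (y * z) := QuotientGroup.eq.2 (hf d.1 hd _ _ fun i => by
    have := hd.conj_mem _ (hxy i) (z i)⁻¹
    simpa [mul_assoc] using this)
  show _ ∈ d.1
  rw [← QuotientGroup.eq_one_iff]
  simp only [QuotientGroup.mk_mul, QuotientGroup.mk_inv]
  rw [h1, h2, inv_mul_cancel]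

theorem CentralMod.sup_right {H' : {N : Subgroup G // N.Normal}} (h : CentralMod σ τ H)
    (h' : CentralMod σ τ H') : CentralMod σ τ (H ⊔ H') := by
  intro m f hf x y z hxy hz
  have hH := H'.2
  choose s hs t ht hst using fun i => Subgroup.mem_sup_of_normal_right.1 (hxy i)
  have h1 := h m f hf x (x * s) z (fun i => by simpa using hs i) hz
  have h2 := h' m f hf (x * s) y z (fun i => by
    have := ht i
    rw [show y i = x i * (s i * t i) by rw [hst]; group]
    simpa [mul_assoc] using this) hz
  have h3 := σ.1.mul_mem h1 h2
  convert h3 using 1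
  group

theorem pow_mem_inf {p : ℕ} (h : ∀ z ∈ τ.1, z ^ p ∈ σ.1) (α : {N : Subgroup G // N.Normal}) :
    ∀ z ∈ (τ ⊓ α).1, z ^ p ∈ (σ ⊓ α).1 :=
  fun z hz => ⟨h z hz.1, α.1.pow_mem hz.2 p⟩

theorem pow_mem_sup {p : ℕ} (h : ∀ z ∈ τ.1, z ^ p ∈ σ.1) (α : {N : Subgroup G // N.Normal}) :
    ∀ z ∈ (τ ⊔ α).1, z ^ p ∈ (σ ⊔ α).1 := by
  intro z hz
  have hα := α.2
  have hσα := (σ ⊔ α).2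
  obtain ⟨t, ht, r, hr, rfl⟩ := Subgroup.mem_sup_of_normal_right.1 hz
  have h1 : (r : G ⧸ (σ ⊔ α).1) = 1 :=
    (QuotientGroup.eq_one_iff r).2 ((le_sup_right : α ≤ σ ⊔ α) hr)
  have h2 : ((t ^ p : G) : G ⧸ (σ ⊔ α).1) = 1 :=
    (QuotientGroup.eq_one_iff _).2 ((le_sup_left : σ ≤ σ ⊔ α) (h t ht))
  rw [← QuotientGroup.eq_one_iff]
  rw [QuotientGroup.mk_pow] at h2 ⊢
  rw [QuotientGroup.mk_mul, h1, mul_one, h2]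

theorem M2Free.exists_third (hM2 : M2Free {N : Subgroup G // N.Normal})
    {x b d : {N : Subgroup G // N.Normal}} (hb : x ⋖ b) (hd : x ⋖ d) (hbd : b ≠ d) :
    ∃ e, b ⊓ e = x ∧ d ⊓ e = x ∧ b ⊔ e = b ⊔ d ∧ d ⊔ e = b ⊔ d := by
  have := isModularLattice_normalSubgroup (G := G)
  have hinf : b ⊓ d = x := by
    have h1 : b ⊓ d < b := inf_le_left.lt_of_ne fun h =>
      hbd (((hd.eq_or_eq hb.le (inf_eq_left.1 h)).resolve_left hb.ne'))
    exact (hb.eq_or_eq (le_inf hb.le hd.le) h1.le).resolve_right h1.ne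
  have hb' : b ⋖ b ⊔ d := covBy_sup_of_inf_covBy_right (hinf ▸ hd)
  have hd' : d ⋖ b ⊔ d := covBy_sup_of_inf_covBy_left (hinf ▸ hb)
  have hbd1 : ¬ b ≤ d := fun h => hb.ne (by rw [← hinf, inf_eq_left.2 h])
  have hbd2 : ¬ d ≤ b := fun h => hd.ne (by rw [← hinf, inf_eq_right.2 h])
  obtain ⟨e, hxe, he, hex, heb, hed, hebd⟩ :
      ∃ e, x ≤ e ∧ e ≤ b ⊔ d ∧ e ≠ x ∧ e ≠ b ∧ e ≠ d ∧ e ≠ b ⊔ d := by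
    by_contra! hcon
    refine hM2 ⟨x, b, d, b ⊔ d, hb.lt, hd.lt, hb'.lt, hd'.lt, hbd1, hbd2, fun y hy1 hy2 => ?_⟩
    by_contra! hy
    exact hy.2.2.2 (hcon y hy1 hy2 hy.1 hy.2.1 hy.2.2.1)
  have key : ∀ c, x ⋖ c → c ⋖ b ⊔ d → e ≠ c → c ⊓ e = x ∧ c ⊔ e = b ⊔ d := by
    intro c hc hc' hec
    constructor
    · refine (hc.eq_or_eq (le_inf hc.le hxe) inf_le_left).resolve_right fun h => ?_
      rcases hc'.eq_or_eq (inf_eq_left.1 h) he with h | h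
      exacts [hec h, hebd h]
    · refine (hc'.eq_or_eq le_sup_left (sup_le hc'.le he)).resolve_left fun h => ?_
      rcases hc.eq_or_eq hxe (sup_eq_left.1 h) with h | h
      exacts [hex h, hec h]
  exact ⟨e, (key b hb hb' heb).1, (key d hd hd' hed).1, (key b hb hb' heb).2,
    (key d hd hd' hed).2⟩

/-- There is a chain from `σ` to `H` whose steps are central and of exponent `p`. -/
inductive CentralChain (p : ℕ) (H : {N : Subgroup G // N.Normal}) :
    {N : Subgroup G // N.Normal} → Prop
  | refl : CentralChain p H H
  | step {σ τ : {N : Subgroup G // N.Normal}} : σ ≤ τ → CentralMod σ τ H →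
      (∀ z ∈ τ.1, z ^ p ∈ σ.1) → CentralChain p H τ → CentralChain p H σ

theorem CentralChain.exists_gt {p : ℕ} {c : {N : Subgroup G // N.Normal}}
    (h : CentralChain p H c) {α : {N : Subgroup G // N.Normal}} (hαH : α ≤ H) (hα : ¬ α ≤ c) :
    ∃ b, c ⊓ α < b ∧ b ≤ α ∧ CentralMod (c ⊓ α) b H ∧ ∀ z ∈ b.1, z ^ p ∈ (c ⊓ α).1 := by
  induction h with
  | refl => exact (hα hαH).elim
  | @step σ τ hστ hc hp _ ih =>
    rcases (inf_le_inf_right α hστ).eq_or_lt with heq | hlt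
    · rw [heq]
      refine ih fun h => hα ?_
      rw [← inf_eq_right, heq, inf_eq_right]
      exact h
    · exact ⟨τ ⊓ α, hlt, inf_le_right, hc.inf α, pow_mem_inf hp α⟩

theorem CentralMod.commute (h : CentralMod σ τ H) {u v : G} (hu : u ∈ τ.1) (hv : v ∈ H.1) :
    haveI := σ.2; Commute (u : G ⧸ σ.1) (v : G ⧸ σ.1) := by
  have hσ := σ.2
  have h1 := h 2 (fun x => x 0 * x 1) ((Compatible.proj 0).mul (Compatible.proj 1))
    1 ![1, v] ![u, 1] (by intro i; fin_cases i <;> simp [hv])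
    (by intro i; fin_cases i <;> simp [hu])
  have h2 : (u : G ⧸ σ.1) = ((v⁻¹ * (u * v) : G) : G ⧸ σ.1) := by
    rw [QuotientGroup.eq]
    simpa using h1
  rw [QuotientGroup.mk_mul, QuotientGroup.mk_mul, QuotientGroup.mk_inv,
    eq_inv_mul_iff_mul_eq] at h2
  exact h2.symm

theorem CentralMod.exists_prime [Finite G] (h : CentralMod σ H H) (hσ : σ ⋖ H) :
    ∃ p : ℕ, p.Prime ∧ ∀ z ∈ H.1, z ^ p ∈ σ.1 := by
  have hσn := σ.2
  have hcomm := fun u hu v hv => h.commute (u := u) (v := v) hu hv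
  obtain ⟨z, hz, hzσ⟩ := SetLike.exists_of_lt (show σ.1 < H.1 from hσ.lt)
  let q : G ⧸ σ.1 := z
  have hq : orderOf q ≠ 1 := fun h => hzσ ((QuotientGroup.eq_one_iff z).1 (orderOf_eq_one_iff.1 h))
  refine ⟨(orderOf q).minFac, Nat.minFac_prime hq, ?_⟩
  set p := (orderOf q).minFac
  let P : Subgroup G :=
    { carrier := {z | z ∈ H.1 ∧ (z : G ⧸ σ.1) ^ p = 1}
      one_mem' := ⟨H.1.one_mem, by simp⟩
      mul_mem' := fun {a b} ha hb => ⟨H.1.mul_mem ha.1 hb.1, by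
        rw [QuotientGroup.mk_mul, (hcomm a ha.1 b hb.1).mul_pow, ha.2, hb.2, one_mul]⟩
      inv_mem' := fun {a} ha => ⟨H.1.inv_mem ha.1, by
        rw [QuotientGroup.mk_inv, inv_pow, ha.2, inv_one]⟩ }
  have hP : P.Normal := ⟨fun a ha g => ⟨H.2.conj_mem a ha.1 g, by
    rw [QuotientGroup.mk_mul, QuotientGroup.mk_mul, QuotientGroup.mk_inv, conj_pow, ha.2]
    simp⟩⟩
  have hPH : (⟨P, hP⟩ : {N : Subgroup G // N.Normal}) = H := by
    have hσP : σ.1 ≤ P := fun a ha => ⟨hσ.le ha, by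
      rw [(QuotientGroup.eq_one_iff a).2 ha, one_pow]⟩
    have hPH : P ≤ H.1 := fun a ha => ha.1
    refine (hσ.eq_or_eq (c := ⟨P, hP⟩) hσP hPH).resolve_left fun heq => ?_
    · obtain ⟨n, hn⟩ := Nat.minFac_dvd (orderOf q)
      have h1 : z ^ n ∈ P := by
        refine ⟨H.1.pow_mem hz n, ?_⟩
        rw [QuotientGroup.mk_pow, ← pow_mul, mul_comm, ← hn, pow_orderOf_eq_one]
      have h2 : z ^ n ∈ σ.1 := by rw [← heq]; exact h1
      rw [← QuotientGroup.eq_one_iff, QuotientGroup.mk_pow] at h2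
      have h3 := orderOf_dvd_of_pow_eq_one h2
      have h4 : 0 < orderOf q := orderOf_pos q
      have h5 : 0 < n := Nat.pos_of_ne_zero fun h0 => by
        rw [h0, mul_zero] at hn; omega
      have h6 := Nat.le_of_dvd h5 h3
      have h7 := (Nat.minFac_prime hq).two_le
      change orderOf q ≤ n at h6
      nlinarith
  intro a ha
  have : a ∈ P := by
    have := hPH.symm ▸ ha
    exact this
  rw [← QuotientGroup.eq_one_iff, QuotientGroup.mk_pow]
  exact this.2

theorem Cuts.exists_incomparable {S c : {N : Subgroup G // N.Normal}} (hS : Cuts S) (hH : Cuts H)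
    (hSc : S ≤ c) (hcH : c ≤ H) (hc : ¬ Cuts c) : ∃ α, S ≤ α ∧ α ≤ H ∧ ¬ α ≤ c ∧ ¬ c ≤ α := by
  unfold Cuts at hc
  push Not at hc
  obtain ⟨α, h1, h2⟩ := hc
  exact ⟨α, (hS α).resolve_left fun h => h1 (h.trans hSc),
    (hH α).resolve_right fun h => h2 (hcH.trans h), h1, h2⟩

/-- An interval between consecutive cutting elements that is not a prime quotient has a chain with
central steps of prime exponent. -/
theorem M2Free.exists_centralChain [Finite G] (hM2 : M2Free {N : Subgroup G // N.Normal})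
    {S K : {N : Subgroup G // N.Normal}} (hS : Cuts S) (hH : Cuts H) (hSK : S < K) (hKH : K < H)
    (hnone : ∀ c, S < c → c < H → ¬ Cuts c) : ∃ p : ℕ, p.Prime ∧ CentralChain p H S := by
  have := isModularLattice_normalSubgroup (G := G)
  obtain ⟨b, hSb, hbH⟩ := exists_le_covBy_of_lt (hSK.trans hKH)
  have hSb' : S < b := hSb.lt_of_ne fun h => (h ▸ hbH).2 hSK hKH
  obtain ⟨α, hSα, hαH, hαb, hbα⟩ := hS.exists_incomparable hH hSb hbH.le (hnone b hSb' hbH.lt)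
  obtain ⟨d, hαd, hdH⟩ := exists_le_covBy_of_lt (hαH.lt_of_ne fun h => hbα (h ▸ hbH.le))
  have hbd : b ≠ d := fun h => hαb (h ▸ hαd)
  have hsup : b ⊔ d = H := (hbH.eq_or_eq le_sup_left (sup_le hbH.le hdH.le)).resolve_left
    fun h => hbd ((hdH.eq_or_eq (sup_eq_left.1 h) hbH.le).resolve_right hbH.ne)
  have hxb : b ⊓ d ⋖ b := inf_covBy_of_covBy_sup_right (hsup ▸ hdH)
  have hxd : b ⊓ d ⋖ d := inf_covBy_of_covBy_sup_left (hsup ▸ hbH)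
  obtain ⟨e, hbe, hde, hbe', hde'⟩ := hM2.exists_third hxb hxd hbd
  have hbH' : CentralMod (b ⊓ d) b H := by
    have := (CentralMod.of_inf b d).sup_right (hbe ▸ CentralMod.of_inf b e)
    rwa [hde', hsup] at this
  have hdH' : CentralMod d H H := by
    have := hbH'.sup d
    rwa [hsup, sup_eq_right.2 inf_le_right] at this
  obtain ⟨p, hp, hpow⟩ := hdH'.exists_prime hdH
  refine ⟨p, hp, ?_⟩
  obtain ⟨c, hc⟩ := (Set.toFinite {c | S ≤ c ∧ c < H ∧ CentralChain p H c}).exists_minimal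
    ⟨d, hSα.trans hαd, hdH.lt, .step hdH.le hdH' hpow .refl⟩
  obtain ⟨hSc, hcH, hchain⟩ := hc.prop
  rcases hSc.eq_or_lt with rfl | hSc'
  · exact hchain
  exfalso
  obtain ⟨β, hSβ, hβH, hβc, hcβ⟩ := hS.exists_incomparable hH hSc hcH.le (hnone c hSc' hcH)
  obtain ⟨x, hβx, hxc⟩ := exists_le_covBy_of_lt (inf_lt_right.2 hcβ : β ⊓ c < c)
  have hxinf : c ⊓ (x ⊔ β) = x := by
    rw [inf_comm, sup_inf_assoc_of_le β hxc.le, sup_eq_left.2 hβx]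
  obtain ⟨b₀, hxb₀, hb₀, hcen, hpw⟩ := hchain.exists_gt (α := x ⊔ β)
    (sup_le (hxc.le.trans hcH.le) hβH) fun h => hβc (le_sup_right.trans h)
  rw [hxinf] at hxb₀ hcen hpw
  obtain ⟨y, hxy, hyb₀⟩ := exists_covBy_le_of_lt hxb₀
  have hyc : y ≠ c := fun h => hxc.lt.not_ge (by
    rw [← hxinf]
    exact le_inf le_rfl (h ▸ hyb₀.trans hb₀))
  obtain ⟨e, hye, hce, hye', hce'⟩ := hM2.exists_third hxy hxc hyc
  have hxe : x ≤ e := hye ▸ inf_le_right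
  have hc1 : b₀ ⊓ y = y := inf_eq_right.2 hyb₀
  have hc2 : x ⊓ y = x := inf_eq_left.2 hxy.le
  have hc3 : x ⊔ e = e := sup_eq_right.2 hxe
  have hc4 : (y ⊔ e) ⊓ c = c := by rw [hye']; exact inf_eq_right.2 le_sup_right
  have hc5 : e ⊓ c = x := by rw [inf_comm, hce]
  have hcen' := ((hcen.inf y).sup e).inf c
  have hpw' := pow_mem_inf (pow_mem_sup (pow_mem_inf hpw y) e) c
  rw [hc1, hc2, hc3, hc4, hc5] at hcen' hpw'
  exact hxc.lt.not_ge (hc.le_of_le ⟨(le_inf hSβ hSc).trans hβx, hxc.lt.trans hcH,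
    .step hxc.le hcen' hpw' hchain⟩ hxc.le)

end Centrality

section LowDegree

variable {X : Type*} {p k : ℕ}

/-- The span of the functions that depend on at most `d` coordinates. -/
def lowDegree (p : ℕ) (X : Type*) (k d : ℕ) : Submodule (ZMod p) ((Fin k → X) → ZMod p) :=
  Submodule.span _ {u | ∃ I : Finset (Fin k), I.card ≤ d ∧ DependsOnlyOn u I}

theorem lowDegree_mono {d e : ℕ} (h : d ≤ e) : lowDegree p X k d ≤ lowDegree p X k e :=
  Submodule.span_mono fun _ ⟨I, hI, hu⟩ => ⟨I, hI.trans h, hu⟩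

theorem const_mem_lowDegree (d : ℕ) (c : ZMod p) : (fun _ => c) ∈ lowDegree p X k d :=
  Submodule.subset_span ⟨∅, by simp, fun _ _ _ => rfl⟩

theorem coord_mem_lowDegree (f : X → ZMod p) (i : Fin k) :
    (fun x => f (x i)) ∈ lowDegree p X k 1 :=
  Submodule.subset_span ⟨{i}, by simp, fun x y h => by
    simp only [h i (Finset.mem_singleton_self i)]⟩

theorem mul_mem_lowDegree {d e : ℕ} {u v : (Fin k → X) → ZMod p} (hu : u ∈ lowDegree p X k d)
    (hv : v ∈ lowDegree p X k e) : u * v ∈ lowDegree p X k (d + e) := by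
  classical
  have h := Submodule.mul_mem_mul hu hv
  rw [lowDegree, lowDegree, Submodule.span_mul_span] at h
  refine Submodule.span_mono ?_ h
  rintro _ ⟨u, ⟨I, hI, hu⟩, v, ⟨J, hJ, hv⟩, rfl⟩
  refine ⟨I ∪ J, (Finset.card_union_le I J).trans (by omega), fun x y hxy => ?_⟩
  simp only [Pi.mul_apply]
  rw [hu x y fun i hi => hxy i (Finset.mem_union_left _ hi),
    hv x y fun i hi => hxy i (Finset.mem_union_right _ hi)]

theorem prod_mem_lowDegree {d : ℕ} {ι : Type*} (s : Finset ι) {u : ι → (Fin k → X) → ZMod p}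
    (hu : ∀ i ∈ s, u i ∈ lowDegree p X k d) : ∏ i ∈ s, u i ∈ lowDegree p X k (s.card * d) := by
  classical
  induction s using Finset.induction_on with
  | empty =>
    rw [Finset.prod_empty, Finset.card_empty, zero_mul]
    exact const_mem_lowDegree 0 1
  | insert i s hi ih =>
    rw [Finset.prod_insert hi, Finset.card_insert_of_notMem hi, add_mul, one_mul, add_comm]
    exact mul_mem_lowDegree (hu i (by simp)) (ih fun j hj => hu j (by simp [hj]))

theorem comp_mem_lowDegree {Y : Type*} [Finite Y] [DecidableEq Y] {d m : ℕ} {w : Fin m → (Fin k → X) → Y}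
    (hw : ∀ j q, (fun x => if w j x = q then 1 else 0) ∈ lowDegree p X k d)
    (ψ : (Fin m → Y) → ZMod p) : (fun x => ψ fun j => w j x) ∈ lowDegree p X k (m * d) := by
  have := Fintype.ofFinite Y
  have h : (fun x => ψ fun j => w j x) =
      ∑ q : Fin m → Y, ψ q • ∏ j, fun x => if w j x = q j then (1 : ZMod p) else 0 := by
    ext x
    rw [Finset.sum_apply, Finset.sum_eq_single fun j => w j x]
    · simp
    · intro q _ hq
      obtain ⟨j, hj⟩ := Function.ne_iff.1 hq
      rw [Pi.smul_apply, Finset.prod_apply, Finset.prod_eq_zero (Finset.mem_univ j), smul_zero]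
      exact if_neg hj.symm
    · simp
  rw [h]
  refine Submodule.sum_mem _ fun q _ => Submodule.smul_mem _ _ ?_
  simpa using prod_mem_lowDegree (p := p) (d := d) Finset.univ
    fun (j : Fin m) _ => hw j (q j)

open Classical in
theorem indicator_mem_lowDegree [Fact p.Prime] {d : ℕ} {u : (Fin k → X) → ZMod p}
    (hu : u ∈ lowDegree p X k d) (t : ZMod p) :
    (fun x => if u x = t then 1 else 0) ∈ lowDegree p X k ((p - 1) * d) := by
  have hp := (Fact.out : p.Prime).two_le
  have h : (fun x => if u x = t then (1 : ZMod p) else 0) =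
      (fun _ => 1) - ∏ _i : Fin (p - 1), (u - fun _ => t) := by
    ext x
    by_cases hx : u x = t
    · simp [hx, show p - 1 ≠ 0 by omega]
    · simp [hx, ZMod.pow_card_sub_one_eq_one (sub_ne_zero.2 hx)]
  rw [h]
  refine Submodule.sub_mem _ (const_mem_lowDegree _ _) ?_
  simpa using prod_mem_lowDegree (Finset.univ : Finset (Fin (p - 1)))
    fun _ _ => Submodule.sub_mem _ hu (const_mem_lowDegree d t)

open Classical in
/-- The conjunction of `k` nonconstant conditions is not a sum of functions depending on fewer
than `k` coordinates. -/
theorem conj_notMem_lowDegree [Fact p.Prime] {A : Set X} {a b : X} (ha : a ∈ A) (hb : b ∉ A)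
    {d : ℕ} (hd : d < k) :
    (fun x => if ∀ i, x i ∈ A then 1 else 0) ∉ lowDegree p X k d := by
  let pt : Finset (Fin k) → Fin k → X := fun T i => if i ∈ T then a else b
  have hzero : ∀ u ∈ lowDegree p X k d,
      ∑ T : Finset (Fin k), (-1 : ZMod p) ^ T.card * u (pt T) = 0 := by
    intro u hu
    induction hu using Submodule.span_induction with
    | mem u hu =>
      obtain ⟨I, hI, hu⟩ := hu
      obtain ⟨j, hj⟩ : ∃ j, j ∉ I := by
        by_contra! h
        have := Finset.card_le_card (fun j _ => h j : (Finset.univ : Finset (Fin k)) ⊆ I)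
        simp at this
        omega
      have hflip : ∀ T, j ∉ T → u (pt (insert j T)) = u (pt T) := fun T _ =>
        hu _ _ fun i hi => by
          have : i ≠ j := fun h => hj (h ▸ hi)
          simp [pt, this]
      rw [← Finset.powerset_univ, ← Finset.insert_erase (Finset.mem_univ j),
        Finset.sum_powerset_insert (by simp), ← Finset.sum_add_distrib]
      refine Finset.sum_eq_zero fun T hT => ?_
      have hjT : j ∉ T := fun h => by simpa using Finset.mem_powerset.1 hT h
      rw [hflip T hjT, Finset.card_insert_of_notMem hjT]
      ring
    | zero => simp
    | add u v _ _ hu hv => simp [mul_add, Finset.sum_add_distrib, hu, hv]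
    | smul c u _ hu =>
      simp only [Pi.smul_apply, smul_eq_mul, mul_left_comm _ c, ← Finset.mul_sum, hu, mul_zero]
  intro h
  have h1 := hzero _ h
  rw [Finset.sum_eq_single Finset.univ] at h1
  · simp [pt, ha] at h1
  · intro T _ hT
    obtain ⟨i, hi⟩ : ∃ i, i ∉ T := by
      by_contra! h
      exact hT (Finset.eq_univ_of_forall h)
    rw [if_neg fun h => hb (by simpa [pt, hi] using h i), mul_zero]
  · simp

end LowDegree

section DegreeBound

theorem InClone.comp_induction {A : Type*} {F : Set (FinOp A)} {k : ℕ}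
    {P : ((Fin k → A) → A) → Prop} (hproj : ∀ i, P fun x => x i)
    (hbase : ∀ (n : ℕ) (f : (Fin n → A) → A), (⟨n, f⟩ : FinOp A) ∈ F →
      ∀ g : Fin n → (Fin k → A) → A, (∀ j, InClone F (g j)) → (∀ j, P (g j)) →
        P fun x => f fun j => g j x)
    {g : (Fin k → A) → A} (hg : InClone F g) : P g := by
  have key : ∀ {n : ℕ} {f : (Fin n → A) → A}, InClone F f → ∀ g : Fin n → (Fin k → A) → A,
      (∀ j, InClone F (g j)) → (∀ j, P (g j)) → P fun x => f fun j => g j x := by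
    intro n f hf
    induction hf with
    | proj i => exact fun g _ hP => hP i
    | base f hf => exact fun g hg hP => hbase _ f hf g hg hP
    | comp f h _ hh ihf ihh =>
      exact fun g hg hP => ihf (fun i x => h i fun j => g j x)
        (fun i => InClone.comp _ _ (hh i) hg) fun i => ihh i g hg hP
  exact key hg (fun i x => x i) (fun i => InClone.proj i) hproj

variable {G : Type*} [Group G] {σ τ H : {N : Subgroup G // N.Normal}} {p k m : ℕ}

/-- Homomorphisms from `τ` to `ZMod p` that vanish on `σ`, extended arbitrarily to `G`. -/
def HomMod (σ τ : {N : Subgroup G // N.Normal}) (p : ℕ) : Set (G → ZMod p) :=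
  {l | (∀ y ∈ τ.1, ∀ z ∈ τ.1, l (y * z) = l y + l z) ∧ ∀ y ∈ σ.1, l y = 0}

theorem HomMod.map_one {l : G → ZMod p} (hl : l ∈ HomMod σ τ p) : l 1 = 0 :=
  hl.2 1 σ.1.one_mem

theorem CentralMod.homMod_map_mul (h : CentralMod σ τ H) (hστ : σ ≤ τ) (hτH : τ ≤ H)
    {l : G → ZMod p} (hl : l ∈ HomMod σ τ p) {f : (Fin m → G) → G} (hf : Compatible f)
    (b : Fin m → G) {y z : Fin m → G} (hy : ∀ i, y i ∈ τ.1) (hz : ∀ i, z i ∈ τ.1) :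
    l ((f b)⁻¹ * f (b * (y * z))) = l ((f b)⁻¹ * f (b * y)) + l ((f b)⁻¹ * f (b * z)) := by
  have hτ : ∀ w : Fin m → G, (∀ i, w i ∈ τ.1) → (f b)⁻¹ * f (b * w) ∈ τ.1 := fun w hw =>
    hf τ.1 τ.2 _ _ fun i => by simpa using hw i
  have h1 := h m f hf b (b * y) z (fun i => hτH (by simpa using hy i)) hz
  have h2 : (f b)⁻¹ * f (b * (y * z)) = ((f b)⁻¹ * f (b * y)) * (((f b)⁻¹ * f (b * z)) *
      (((f b)⁻¹ * f (b * z))⁻¹ * ((f (b * y))⁻¹ * f (b * y * z)))) := by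
    rw [mul_assoc b y z]
    group
  rw [h2, hl.1 _ (hτ y hy) _ (τ.1.mul_mem (hτ z hz) (hστ h1)), hl.1 _ (hτ z hz) _ (hστ h1),
    hl.2 _ h1, add_zero]

theorem CentralMod.mulSingle_mem_homMod (h : CentralMod σ τ H) (hστ : σ ≤ τ) (hτH : τ ≤ H)
    {l : G → ZMod p} (hl : l ∈ HomMod σ τ p) {f : (Fin m → G) → G} (hf : Compatible f)
    (b : Fin m → G) (j : Fin m) :
    (fun t : G => l ((f b)⁻¹ * f (b * Pi.mulSingle j t))) ∈ HomMod σ τ p := by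
  have hmem : ∀ (N : Subgroup G), ∀ t ∈ N, ∀ i, (Pi.mulSingle j t : Fin m → G) i ∈ N := by
    intro N t ht i
    rcases eq_or_ne i j with rfl | hij
    · simpa using ht
    · simp [hij]
  refine ⟨fun y hy z hz => ?_, fun y hy => hl.2 _ (hf σ.1 σ.2 _ _ fun i => ?_)⟩
  · simp only [Pi.mulSingle_mul]
    exact h.homMod_map_mul hστ hτH hl hf b (hmem _ y hy) (hmem _ z hz)
  · simpa using hmem _ y hy i

theorem CentralMod.homMod_eq_sum (h : CentralMod σ τ H) (hστ : σ ≤ τ) (hτH : τ ≤ H)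
    {l : G → ZMod p} (hl : l ∈ HomMod σ τ p) {f : (Fin m → G) → G} (hf : Compatible f)
    (b : Fin m → G) {z : Fin m → G} (hz : ∀ i, z i ∈ τ.1) :
    l ((f b)⁻¹ * f (b * z)) = ∑ j, l ((f b)⁻¹ * f (b * Pi.mulSingle j (z j))) := by
  classical
  have key : ∀ T : Finset (Fin m), l ((f b)⁻¹ * f (b * fun j => if j ∈ T then z j else 1)) =
      ∑ j ∈ T, l ((f b)⁻¹ * f (b * Pi.mulSingle j (z j))) := by
    intro T
    induction T using Finset.induction_on with
    | empty =>
      have : (b * fun j => if j ∈ (∅ : Finset (Fin m)) then z j else 1) = b := by ext; simp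
      rw [this, inv_mul_cancel, HomMod.map_one hl, Finset.sum_empty]
    | insert j T hj ih =>
      have h1 : (fun i => if i ∈ insert j T then z i else 1) =
          Pi.mulSingle j (z j) * fun i => if i ∈ T then z i else 1 := by
        ext i
        rcases eq_or_ne i j with rfl | hij
        · simp [hj]
        · simp [hij]
      rw [h1, h.homMod_map_mul hστ hτH hl hf b, ih, Finset.sum_insert hj]
      · intro i
        rcases eq_or_ne i j with rfl | hij
        · simpa using hz i
        · simp [hij]
      · intro i
        split_ifs
        exacts [hz i, τ.1.one_mem]
  simpa using key Finset.univ

theorem exists_forall_map_mul_and_ne_zero {T : Type*} [CommGroup T] [Fact p.Prime]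
    (hp : ∀ t : T, t ^ p = 1) {t : T} (ht : t ≠ 1) :
    ∃ φ : T → ZMod p, (∀ x y, φ (x * y) = φ x + φ y) ∧ φ t ≠ 0 := by
  let _ : Module (ZMod p) (Additive T) := AddCommGroup.zmodModule (n := p) hp
  by_contra! hc
  exact ht ((Module.forall_dual_apply_eq_zero_iff (ZMod p) (Additive.ofMul t)).1 fun φ =>
    hc (fun x => φ (Additive.ofMul x)) fun x y => map_add φ _ _)

theorem HomMod.exists_ne_zero [Fact p.Prime] (h : CentralMod σ τ H) (hτH : τ ≤ H)
    (hp : ∀ z ∈ τ.1, z ^ p ∈ σ.1) {z : G} (hz : z ∈ τ.1) (hzσ : z ∉ σ.1) :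
    ∃ l ∈ HomMod σ τ p, l z ≠ 0 := by
  classical
  have hσ := σ.2
  let T : Subgroup (G ⧸ σ.1) := τ.1.map (QuotientGroup.mk' σ.1)
  let _ : CommGroup T :=
    { (inferInstance : Group T) with
      mul_comm := by
        rintro ⟨_, u, hu, rfl⟩ ⟨_, v, hv, rfl⟩
        exact Subtype.ext (h.commute hu (hτH hv)) }
  have hmem : ∀ y ∈ τ.1, (y : G ⧸ σ.1) ∈ T := fun y hy => ⟨y, hy, rfl⟩
  obtain ⟨φ, hφ, hφz⟩ := exists_forall_map_mul_and_ne_zero (T := T) (p := p) (by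
      rintro ⟨_, u, hu, rfl⟩
      exact Subtype.ext ((QuotientGroup.eq_one_iff (u ^ p)).2 (hp u hu)))
    (t := ⟨(z : G ⧸ σ.1), hmem z hz⟩)
    fun hc => hzσ ((QuotientGroup.eq_one_iff z).1 (congrArg Subtype.val hc))
  let l : G → ZMod p := fun y => if hy : (y : G ⧸ σ.1) ∈ T then φ ⟨(y : G ⧸ σ.1), hy⟩ else 0
  have hl : ∀ (y : G) (hy : (y : G ⧸ σ.1) ∈ T), l y = φ ⟨(y : G ⧸ σ.1), hy⟩ := fun y hy => dif_pos hy
  refine ⟨l, ⟨fun y hy z hz => ?_, fun y hy => ?_⟩, by rwa [hl z (hmem z hz)]⟩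
  · rw [hl _ (hmem _ (τ.1.mul_mem hy hz)), hl _ (hmem _ hy), hl _ (hmem _ hz), ← hφ]
    rfl
  · have h1 : (y : G ⧸ σ.1) = 1 := (QuotientGroup.eq_one_iff y).2 hy
    have h2 : φ 1 = 0 := by simpa using hφ 1 1
    rw [hl y (h1 ▸ T.one_mem), ← h2]
    congr 1
    exact Subtype.ext h1

/-- The increments, inside `H`, of the functions in the clone generated by `F` have degree at most
`d` modulo `c`. -/
def DegreeBound (F : Set (FinOp G)) (p : ℕ) (H c : {N : Subgroup G // N.Normal}) (d : ℕ) : Prop :=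
  ∀ (k : ℕ) (g : (Fin k → G) → G), InClone F g → ∀ (a : Fin k → G) (φ : G → ZMod p),
    (∀ y, ∀ n ∈ c.1, φ (y * n) = φ y) →
      (fun x : Fin k → H.1 => φ ((g a)⁻¹ * g fun i => a i * x i)) ∈ lowDegree p H.1 k d

variable {F : Set (FinOp G)} {d : ℕ}

theorem DegreeBound.self (hF : ∀ f ∈ F, Compatible f.2) : DegreeBound F p H H 0 := by
  intro k g hg a φ hφ
  convert const_mem_lowDegree 0 (φ 1) using 2 with x
  rw [← hφ 1 ((g a)⁻¹ * g fun i => a i * x i) ((hg.compatible hF) H.1 H.2 _ _ fun i => by simp),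
    one_mul]

open Classical in
theorem DegreeBound.indicator (hd : DegreeBound F p H τ d) {g : (Fin k → G) → G}
    (hg : InClone F g) (a : Fin k → G) (q : G ⧸ τ.1) :
    (fun x : Fin k → H.1 => if (((g a)⁻¹ * g fun i => a i * x i : G) : G ⧸ τ.1) = q then 1 else 0) ∈
      lowDegree p H.1 k d :=
  hd k g hg a (fun y => if (y : G ⧸ τ.1) = q then 1 else 0) fun y n hn => by
    rw [QuotientGroup.mk_mul_of_mem y hn]

/-- The difference to the chosen representative modulo `N`. -/
noncomputable def cosetPart (N : Subgroup G) (y : G) : G := ((y : G ⧸ N).out)⁻¹ * y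

theorem cosetPart_mem (N : Subgroup G) (y : G) : cosetPart N y ∈ N :=
  QuotientGroup.eq.1 (QuotientGroup.out_eq' _)

theorem cosetPart_mul {N : Subgroup G} (y : G) {n : G} (hn : n ∈ N) :
    cosetPart N (y * n) = cosetPart N y * n := by
  rw [cosetPart, QuotientGroup.mk_mul_of_mem y hn, ← mul_assoc, cosetPart]

theorem DegreeBound.homMod_cosetPart [Finite G] (hF : ∀ f ∈ F, Compatible f.2)
    (hm : ∀ f ∈ F, f.1 ≤ m)
    (h : CentralMod σ τ H) (hστ : σ ≤ τ) (hτH : τ ≤ H) (hd : DegreeBound F p H τ d)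
    {g : (Fin k → G) → G} (hg : InClone F g) (a : Fin k → G) {l : G → ZMod p}
    (hl : l ∈ HomMod σ τ p) :
    (fun x : Fin k → H.1 => l (cosetPart τ.1 ((g a)⁻¹ * g fun i => a i * x i))) ∈
      lowDegree p H.1 k (m * d + 1) := by
  classical
  refine InClone.comp_induction (P := fun g => ∀ l ∈ HomMod σ τ p,
    (fun x : Fin k → H.1 => l (cosetPart τ.1 ((g a)⁻¹ * g fun i => a i * x i))) ∈
      lowDegree p H.1 k (m * d + 1)) ?_ ?_ hg l hl
  · intro i l hl
    simp only [inv_mul_cancel_left]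
    exact lowDegree_mono (by omega) (coord_mem_lowDegree (fun h : H.1 => l (cosetPart τ.1 h)) i)
  · intro n f hf g hg ih l hl
    have hfc : Compatible f := hF _ hf
    let b : Fin n → G := fun j => g j a
    let u : Fin n → (Fin k → H.1) → G := fun j x => (g j a)⁻¹ * g j fun i => a i * x i
    let ψ : (Fin n → G ⧸ τ.1) → ZMod p := fun q =>
      l (cosetPart τ.1 ((f b)⁻¹ * f (b * fun j => (q j).out)))
    have hu : ∀ j x, u j x ∈ H.1 := fun j x =>
      (hg j).compatible hF H.1 H.2 _ _ fun i => by simp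
    have key : (fun x : Fin k → H.1 => l (cosetPart τ.1 ((f fun j => g j a)⁻¹ *
        f fun j => g j fun i => a i * x i))) = (fun x => ψ fun j => (u j x : G ⧸ τ.1)) +
          ∑ j, fun x => l ((f b)⁻¹ * f (b * Pi.mulSingle j (cosetPart τ.1 (u j x)))) := by
      ext x
      let s : Fin n → G := fun j => (u j x : G ⧸ τ.1).out
      let z : Fin n → G := fun j => cosetPart τ.1 (u j x)
      have hz : ∀ j, z j ∈ τ.1 := fun j => cosetPart_mem _ _
      have hs : ∀ j, s j ∈ H.1 := fun j => by
        have h1 : s j = u j x * (z j)⁻¹ := by simp [s, z, cosetPart]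
        rw [h1]
        exact H.1.mul_mem (hu j x) (hτH (τ.1.inv_mem (hz j)))
      have h1 := h n f hfc b (b * s) z (fun j => by simpa using hs j) hz
      have h2 : (fun j => g j fun i => a i * x i) = b * s * z := by
        ext j
        simp [b, s, z, cosetPart, u]
      have h3 : (f b)⁻¹ * f (b * z) ∈ τ.1 := hfc τ.1 τ.2 _ _ fun i => by simpa using hz i
      have h4 : (f b)⁻¹ * f (b * s * z) = ((f b)⁻¹ * f (b * s)) * (((f b)⁻¹ * f (b * z)) *
          (((f b)⁻¹ * f (b * z))⁻¹ * ((f (b * s))⁻¹ * f (b * s * z)))) := by group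
      rw [Pi.add_apply, Finset.sum_apply, ← h.homMod_eq_sum hστ hτH hl hfc b hz, h2, h4,
        cosetPart_mul _ (τ.1.mul_mem h3 (hστ h1)),
        hl.1 _ (cosetPart_mem _ _) _ (τ.1.mul_mem h3 (hστ h1)), hl.1 _ h3 _ (hστ h1), hl.2 _ h1,
        add_zero]
    rw [key]
    refine Submodule.add_mem _ (lowDegree_mono ?_
      (comp_mem_lowDegree (fun j q => hd.indicator (hg j) a q) ψ)) (Submodule.sum_mem _ fun j _ =>
        ih j _ (h.mulSingle_mem_homMod hστ hτH hl hfc b j))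
    exact (Nat.mul_le_mul_right d (hm _ hf)).trans (Nat.le_succ _)

theorem DegreeBound.step [Finite G] [Fact p.Prime] (hF : ∀ f ∈ F, Compatible f.2)
    (hm : ∀ f ∈ F, f.1 ≤ m) (h : CentralMod σ τ H) (hστ : σ ≤ τ) (hτH : τ ≤ H)
    (hp : ∀ z ∈ τ.1, z ^ p ∈ σ.1) (hd : DegreeBound F p H τ d) : ∃ e, DegreeBound F p H σ e := by
  classical
  have := Fintype.ofFinite (HomMod σ τ p)
  refine ⟨1 * (d + Fintype.card (HomMod σ τ p) * ((p - 1) * (m * d + 1))),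
    fun k g hg a φ hφ => ?_⟩
  have hφ' : ∀ y : G, φ y = φ (y : G ⧸ σ.1).out := fun y => by
    have := hφ (y : G ⧸ σ.1).out _ (cosetPart_mem σ.1 y)
    rwa [cosetPart, mul_inv_cancel_left] at this
  have hind : ∀ q : G ⧸ σ.1, (fun x : Fin k → H.1 =>
      if (((g a)⁻¹ * g fun i => a i * x i : G) : G ⧸ σ.1) = q then (1 : ZMod p) else 0) ∈
        lowDegree p H.1 k
          (d + Fintype.card (HomMod σ τ p) * ((p - 1) * (m * d + 1))) := by
    intro q
    induction q using QuotientGroup.induction_on with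
    | H y₀ =>
    have key : (fun x : Fin k → H.1 =>
        if (((g a)⁻¹ * g fun i => a i * x i : G) : G ⧸ σ.1) = y₀ then (1 : ZMod p) else 0) =
        (fun x => if (((g a)⁻¹ * g fun i => a i * x i : G) : G ⧸ τ.1) = y₀ then 1 else 0) *
          ∏ l : HomMod σ τ p, fun x =>
            if l.1 (cosetPart τ.1 ((g a)⁻¹ * g fun i => a i * x i)) = l.1 (cosetPart τ.1 y₀)
              then 1 else 0 := by
      ext x
      rw [Pi.mul_apply, Finset.prod_apply]
      generalize (g a)⁻¹ * (g fun i => a i * x i) = y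
      by_cases h1 : (y : G ⧸ τ.1) = y₀
      · have h2 : y₀⁻¹ * y = (cosetPart τ.1 y₀)⁻¹ * cosetPart τ.1 y := by
          rw [cosetPart, cosetPart, h1]
          group
        have h3 : (cosetPart τ.1 y₀)⁻¹ * cosetPart τ.1 y ∈ τ.1 :=
          τ.1.mul_mem (τ.1.inv_mem (cosetPart_mem _ _)) (cosetPart_mem _ _)
        have h4 : ∀ l ∈ HomMod σ τ p, l (cosetPart τ.1 y) =
            l (cosetPart τ.1 y₀) + l ((cosetPart τ.1 y₀)⁻¹ * cosetPart τ.1 y) := fun l hl => by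
          rw [← hl.1 _ (cosetPart_mem _ _) _ h3, mul_inv_cancel_left]
        rw [if_pos h1, one_mul]
        by_cases h5 : (y : G ⧸ σ.1) = y₀
        · rw [if_pos h5, Finset.prod_eq_one]
          intro l _
          have h6 := QuotientGroup.eq.1 h5.symm
          rw [h2] at h6
          rw [h4 l.1 l.2, l.2.2 _ h6, add_zero, if_pos rfl]
        · have h6 : (cosetPart τ.1 y₀)⁻¹ * cosetPart τ.1 y ∉ σ.1 := fun h6 =>
            h5 (QuotientGroup.eq.2 (by rwa [h2])).symm
          obtain ⟨l, hl, hne⟩ := HomMod.exists_ne_zero h hτH hp h3 h6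
          rw [if_neg h5, Finset.prod_eq_zero (Finset.mem_univ (⟨l, hl⟩ : HomMod σ τ p))]
          refine if_neg fun h7 => hne ?_
          rwa [← add_eq_left, ← h4 l hl]
      · have h5 : (y : G ⧸ σ.1) ≠ y₀ := fun h5 =>
          h1 (QuotientGroup.eq.2 (hστ (QuotientGroup.eq.1 h5)))
        rw [if_neg h1, if_neg h5, zero_mul]
    rw [key]
    exact mul_mem_lowDegree (hd.indicator hg a _) (prod_mem_lowDegree Finset.univ fun l _ =>
      indicator_mem_lowDegree (hd.homMod_cosetPart hF hm h hστ hτH hg a l.2) _)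
  have := comp_mem_lowDegree (m := 1) (fun _ q => hind q) fun q => φ (q 0).out
  convert this using 2 with x
  exact hφ' _

theorem CentralChain.le (h : CentralChain p H σ) : σ ≤ H := by
  induction h with
  | refl => exact le_rfl
  | step h _ _ _ ih => exact h.trans ih

theorem CentralChain.exists_degreeBound [Finite G] [Fact p.Prime] (hF : ∀ f ∈ F, Compatible f.2)
    (hm : ∀ f ∈ F, f.1 ≤ m) (h : CentralChain p H σ) : ∃ d, DegreeBound F p H σ d := by
  induction h with
  | refl => exact ⟨0, DegreeBound.self hF⟩
  | step hστ hc hp hH ih =>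
    obtain ⟨d, hd⟩ := ih
    exact hd.step hF hm hc hστ hH.le hp

open Classical in
theorem Compatible.conj_of_split {S δ ε : {N : Subgroup G // N.Normal}} (hS : Cuts S)
    (hH : Cuts H) (hSδ : S ≤ δ) (hδH : δ ≤ H) (hεH : ε ≤ H)
    (hsplit : ∀ K : {N : Subgroup G // N.Normal}, S ≤ K → K ≤ H → K ≤ δ ∨ ε ≤ K)
    {e : G} (he : e ∈ ε.1) :
    Compatible fun x : Fin k → G => if ∀ j, x j ∈ H.1 ∧ x j ∉ δ.1 then e else 1 := by
  intro N hN x y hxy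
  have hcases : N ≤ δ.1 ∨ ε.1 ≤ N := by
    rcases hS ⟨N, hN⟩ with h | h
    · exact Or.inl (show (⟨N, hN⟩ : {N : Subgroup G // N.Normal}) ≤ δ from h.trans hSδ)
    rcases hH ⟨N, hN⟩ with h' | h'
    · exact hsplit ⟨N, hN⟩ h h'
    · exact Or.inr (show ε ≤ (⟨N, hN⟩ : {N : Subgroup G // N.Normal}) from hεH.trans h')
  rcases hcases with h | h
  · have hiff : (∀ j, x j ∈ H.1 ∧ x j ∉ δ.1) ↔ ∀ j, y j ∈ H.1 ∧ y j ∉ δ.1 := by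
      refine forall_congr' fun j => ?_
      have h1 := h (hxy j)
      rw [← mul_inv_cancel_left (x j) (y j), H.1.mul_mem_cancel_right (hδH h1),
        δ.1.mul_mem_cancel_right h1]
    simp only [hiff, inv_mul_cancel, N.one_mem]
  · have hmem : ∀ z : Fin k → G, (if ∀ j, z j ∈ H.1 ∧ z j ∉ δ.1 then e else 1) ∈ N := by
      intro z
      split_ifs
      exacts [h he, N.one_mem]
    exact N.mul_mem (N.inv_mem (hmem x)) (hmem y)

theorem CentralChain.not_intervalSplits [Finite G] [Fact p.Prime]
    {S : {N : Subgroup G // N.Normal}} (h : CentralChain p H S) (hS : Cuts S) (hH : Cuts H)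
    (hG : CompFG G) : ¬ IntervalSplits S H := by
  classical
  rintro ⟨δ, ε, hSδ, hδH, hSε, hεH, hsplit⟩
  obtain ⟨F, hfin, hF, hgen⟩ := hG
  obtain ⟨m, hm⟩ := (hfin.image fun f => f.1).bddAbove
  obtain ⟨d, hd⟩ := h.exists_degreeBound (fun f hf => (hF f hf).2)
    fun f hf => hm (Set.mem_image_of_mem _ hf)
  obtain ⟨a, haH, haδ⟩ := SetLike.exists_of_lt (show δ.1 < H.1 from hδH)
  obtain ⟨e, heε, heS⟩ := SetLike.exists_of_lt (show S.1 < ε.1 from hSε)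
  have h1 := hd (d + 1) _ ((hgen _ (by omega) _).1
    (Compatible.conj_of_split hS hH hSδ hδH.le hεH hsplit heε)) 1
    (fun y => if y ∈ S.1 then 0 else 1) fun y n hn => by
      simp only [S.1.mul_mem_cancel_right hn]
  refine conj_notMem_lowDegree (p := p) (A := {x : H.1 | (x : G) ∉ δ.1}) (a := ⟨a, haH⟩) (b := 1)
    haδ (by simp [δ.1.one_mem]) (Nat.lt_succ_self d) ?_
  convert h1 using 2 with x
  by_cases hx : ∀ i, (x i : G) ∉ δ.1
  · simp [hx, heS, δ.1.one_mem]
  · simp [hx, S.1.one_mem, δ.1.one_mem]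

end DegreeBound

/-- Theorem (expanded groups with `M₂`-free ideal lattice, instance for finite
groups): if the lattice `L` of normal subgroups of a finite group `G` is
`M₂`-free and `⊥ = S 0 < ⋯ < S n = ⊤` enumerates the cutting elements of `L`,
then `Comp G` is finitely generated iff each interval `I[S i, S (i+1)]`
contains exactly the two elements `S i, S (i+1)` or does not split. -/
theorem compFG_iff_of_M2Free (G : Type*) [Group G] [Finite G]
    (hM2 : M2Free {H : Subgroup G // H.Normal})
    (n : ℕ) (S : Fin (n + 1) → {H : Subgroup G // H.Normal})
    (hmono : StrictMono S) (h0 : S 0 = ⊥) (hlast : S (Fin.last n) = ⊤)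
    (hcuts : ∀ i, Cuts (S i)) (hall : ∀ M : {H : Subgroup G // H.Normal}, Cuts M → ∃ i, M = S i) :
    CompFG G ↔ ∀ i : Fin n,
      (∀ K : {H : Subgroup G // H.Normal}, S i.castSucc ≤ K → K ≤ S i.succ →
          K = S i.castSucc ∨ K = S i.succ)
        ∨ ¬ IntervalSplits (S i.castSucc) (S i.succ) := by
  refine ⟨fun hG i => ?_, CompFG.of_chain n S hmono h0 hlast hcuts⟩
  rw [or_iff_not_imp_left]
  intro hne
  push Not at hne
  obtain ⟨K, hSK, hKH, hKS, hKH'⟩ := hne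
  obtain ⟨p, hp, hchain⟩ := hM2.exists_centralChain (hcuts i.castSucc) (hcuts i.succ)
    (hSK.lt_of_ne hKS.symm) (hKH.lt_of_ne hKH') fun c hc1 hc2 hc => by
      obtain ⟨j, rfl⟩ := hall c hc
      have h1 := hmono.lt_iff_lt.1 hc1
      have h2 := hmono.lt_iff_lt.1 hc2
      rw [Fin.lt_def] at h1 h2
      simp only [Fin.val_castSucc, Fin.val_succ] at h1 h2
      omega
  have := Fact.mk hp
  exact hchain.not_intervalSplits (hcuts _) (hcuts _) hG
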